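/- For every natural number n ≤ 9, there is no [[n,1,3]] CE CSS code. That is, there do not exist binary linear codes C₂ ⊆ C₁ ⊆ 𝔽₂ⁿ with dim C₁ = dim C₂ + 1, a vector y ∈ 𝔽₂ⁿ, and a natural number w such that: every element of y + C₁ has Hamming weight exactly w, every element of C₁ \ C₂ has Hamming weight ≥ 3, and every element of C₂^⊥ \ C₁^⊥ has Hamming weight ≥ 3. -/

import Mathlib

/-- The dual code of `C`: all vectors orthogonal to every codeword of `C` with
respect to the standard bilinear form over `𝔽₂`. -/
def dualCode {m : ℕ} (C : Submodule (ZMod 2) (Fin m → ZMod 2)) :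
    Set (Fin m → ZMod 2) :=
  {x | ∀ c ∈ C, ∑ i, x i * c i = 0}

theorem ce_erase {n : ℕ} (i0 : Fin n) (A : Finset (Fin n)) (k : ℕ) (h : A.card ≤ k + 1) :
    ∃ p, (A.erase p).card ≤ k := by
  rcases A.eq_empty_or_nonempty with rfl | ⟨p, hp⟩
  · exact ⟨i0, by simp⟩
  · exact ⟨p, by rw [Finset.card_erase_of_mem hp]; omega⟩

theorem ce_cover {n : ℕ} (i0 : Fin n) (A : Finset (Fin n)) (h : A.card ≤ 4) :
    ∃ p q r s, ∀ i ∈ A, i = p ∨ i = q ∨ i = r ∨ i = s := by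
  obtain ⟨p, hp⟩ := ce_erase i0 A 3 h
  obtain ⟨q, hq⟩ := ce_erase i0 _ 2 hp
  obtain ⟨r, hr⟩ := ce_erase i0 _ 1 hq
  obtain ⟨s, hs⟩ := ce_erase i0 _ 0 hr
  refine ⟨p, q, r, s, fun i hi => ?_⟩
  by_contra hc
  push Not at hc
  have : i ∈ (((A.erase p).erase q).erase r).erase s := by simp [hi, hc]
  have h2 := Finset.card_pos.2 ⟨i, this⟩
  omega

theorem zmod2_eq_one : ∀ a : ZMod 2, a ≠ 0 → a = 1 := by decide

theorem ce_core {n : ℕ} (C₁ C₂ : Submodule (ZMod 2) (Fin n → ZMod 2)) (A : Finset (Fin n))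
    (hA : A.card ≤ 4) (hle : C₂ ≤ C₁)
    (hdim : Module.finrank (ZMod 2) C₁ = Module.finrank (ZMod 2) C₂ + 1)
    (hw : ∀ c ∈ C₁, hammingNorm c = 2 * (A.filter (fun i => c i ≠ 0)).card)
    (hX : ∀ v ∈ C₁, v ∉ C₂ → 3 ≤ hammingNorm v)
    (hZ : ∀ x ∈ dualCode C₂, x ∉ dualCode C₁ → 3 ≤ hammingNorm x) : False := by
  have hlt : ∃ x ∈ C₁, x ∉ C₂ := by
    by_contra hc
    push Not at hc
    have : C₁ = C₂ := le_antisymm hc hle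
    rw [this] at hdim
    omega
  obtain ⟨x0, hx1, hx2⟩ := hlt
  obtain ⟨φ, hφ0, hφ⟩ := Submodule.exists_le_ker_of_notMem hx2
  have hk : ∀ c ∈ C₁, (c ∈ C₂ ↔ φ c = 0) := by
    have hle2 : C₂ ≤ C₁ ⊓ LinearMap.ker φ := le_inf hle hφ
    have hlt : C₁ ⊓ LinearMap.ker φ < C₁ := by
      refine lt_of_le_of_ne inf_le_left fun h => hφ0 ?_
      rw [← h] at hx1
      exact hx1.2
    have h1 := Submodule.finrank_lt_finrank_of_lt hlt
    have h2 : C₂ = C₁ ⊓ LinearMap.ker φ :=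
      Submodule.eq_of_le_of_finrank_le hle2 (by omega)
    intro c hc
    rw [h2]
    simp [hc]
  -- cleaning
  have key : ∀ a b : Fin n, ∃ x ∈ C₁, φ x = 1 ∧ x a = 0 ∧ x b = 0 := by
    intro a b
    by_contra hc
    push Not at hc
    let f : Fin 2 → (C₁ →ₗ[ZMod 2] ZMod 2) := fun j =>
      (LinearMap.proj (if j = 0 then a else b)).comp C₁.subtype
    have hs : φ.comp C₁.subtype ∈ Submodule.span (ZMod 2) (Set.range f) := by
      apply mem_span_of_iInf_ker_le_ker
      intro c hcm
      simp only [Submodule.mem_iInf, LinearMap.mem_ker] at hcm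
      have ha : c.1 a = 0 := by simpa [f] using hcm 0
      have hb : c.1 b = 0 := by simpa [f] using hcm 1
      by_contra h
      exact hc c.1 c.2 (zmod2_eq_one _ h) ha hb
    obtain ⟨g, hg⟩ := (Submodule.mem_span_range_iff_exists_fun _).1 hs
    have hg' : ∀ c ∈ C₁, g 0 * c a + g 1 * c b = φ c := by
      intro c hcm
      have := LinearMap.congr_fun hg ⟨c, hcm⟩
      simpa [f, Fin.sum_univ_two] using this
    let z : Fin n → ZMod 2 := Pi.single a (g 0) + Pi.single b (g 1)
    have hz : ∀ c : Fin n → ZMod 2, ∑ i, z i * c i = g 0 * c a + g 1 * c b := by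
      intro c
      simp [z, add_mul, Finset.sum_add_distrib, Pi.single_apply]
    have h3 : 3 ≤ hammingNorm z := by
      apply hZ
      · intro c hcm
        rw [hz, hg' c (hle hcm)]
        exact (hk c (hle hcm)).1 hcm
      · intro h
        have := h x0 hx1
        rw [hz, hg' x0 hx1] at this
        exact hφ0 this
    have h4 : hammingNorm z ≤ ({a, b} : Finset (Fin n)).card := by
      apply Finset.card_le_card
      intro i hi
      simp only [Finset.mem_filter] at hi
      by_contra h
      simp only [Finset.mem_insert, Finset.mem_singleton, not_or] at h
      exact hi.2 (by simp [z, h.1, h.2])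
    have h5 := Finset.card_le_two (a := a) (b := b)
    omega
  have hi0 : ∃ i0, x0 i0 ≠ 0 := by
    by_contra hc
    push Not at hc
    exact hx2 ((funext hc : x0 = 0) ▸ C₂.zero_mem)
  obtain ⟨i0, -⟩ := hi0
  obtain ⟨p, q, r, s, hcov⟩ := ce_cover i0 A hA
  have sup : ∀ x ∈ C₁, φ x = 1 → ∀ t, ¬ (∀ i ∈ A, i = t ∨ x i = 0) := by
    intro x hx hφx t h
    have h1 := hX x hx (fun h => by rw [(hk x hx).1 h] at hφx; exact absurd hφx (by decide))
    rw [hw x hx] at h1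
    have h2 : (A.filter (fun i => x i ≠ 0)).card ≤ ({t} : Finset (Fin n)).card := by
      apply Finset.card_le_card
      intro i hi
      simp only [Finset.mem_filter] at hi
      simpa using (h i hi.1).resolve_right hi.2
    simp only [Finset.card_singleton] at h2
    omega
  obtain ⟨x, hx, fx, xp, xq⟩ := key p q
  obtain ⟨u, hu, fu, up, ur⟩ := key p r
  obtain ⟨v, hv, fv, vp, vs⟩ := key p s
  have xr : x r = 1 := zmod2_eq_one _ fun h => sup x hx fx s fun i hi => by
    rcases hcov i hi with rfl | rfl | rfl | rfl <;> simp [*]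
  have xs : x s = 1 := zmod2_eq_one _ fun h => sup x hx fx r fun i hi => by
    rcases hcov i hi with rfl | rfl | rfl | rfl <;> simp [*]
  have uq : u q = 1 := zmod2_eq_one _ fun h => sup u hu fu s fun i hi => by
    rcases hcov i hi with rfl | rfl | rfl | rfl <;> simp [*]
  have us : u s = 1 := zmod2_eq_one _ fun h => sup u hu fu q fun i hi => by
    rcases hcov i hi with rfl | rfl | rfl | rfl <;> simp [*]
  have vq : v q = 1 := zmod2_eq_one _ fun h => sup v hv fv r fun i hi => by
    rcases hcov i hi with rfl | rfl | rfl | rfl <;> simp [*]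
  have vr : v r = 1 := zmod2_eq_one _ fun h => sup v hv fv q fun i hi => by
    rcases hcov i hi with rfl | rfl | rfl | rfl <;> simp [*]
  have h11 : (1 : ZMod 2) + 1 = 0 := by decide
  refine sup (x + u + v) (C₁.add_mem (C₁.add_mem hx hu) hv) (by simp [fx, fu, fv, h11]) p
    fun i hi => Or.inr ?_
  rcases hcov i hi with h | h | h | h <;> rw [h] <;>
    simp only [Pi.add_apply, xp, up, vp, xq, uq, vq, xr, ur, vr, xs, us, vs] <;> decide

theorem ce_weight {n : ℕ} (y c : Fin n → ZMod 2) (h : hammingNorm (y + c) = hammingNorm y) :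
    (Finset.univ.filter (fun i => y i ≠ 0 ∧ c i ≠ 0)).card
      = (Finset.univ.filter (fun i => y i = 0 ∧ c i ≠ 0)).card := by
  have pt : ∀ a b : ZMod 2, (if a + b ≠ 0 then (1 : ℤ) else 0) + (if a ≠ 0 ∧ b ≠ 0 then 1 else 0)
      = (if a ≠ 0 then 1 else 0) + (if a = 0 ∧ b ≠ 0 then 1 else 0) := by decide
  have hs := Finset.sum_congr rfl (fun (i : Fin n) (_ : i ∈ Finset.univ) => pt (y i) (c i))
  simp only [Finset.sum_add_distrib, Finset.sum_boole] at hs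
  simp only [hammingNorm, Pi.add_apply] at h
  rw [h] at hs
  exact_mod_cast add_left_cancel hs

theorem ce_weight_add {n : ℕ} (y c : Fin n → ZMod 2) : hammingNorm c =
    (Finset.univ.filter (fun i => y i ≠ 0 ∧ c i ≠ 0)).card
      + (Finset.univ.filter (fun i => y i = 0 ∧ c i ≠ 0)).card := by
  rw [hammingNorm, ← Finset.card_filter_add_card_filter_not (fun i => y i ≠ 0)]
  simp only [Finset.filter_filter, not_not, and_comm]

/-- For every `n ≤ 9` there is no `[[n,1,3]]` CE CSS code:
there are no linear codes `C₂ ⊆ C₁ ⊆ 𝔽₂ⁿ` with `dim C₁ = dim C₂ + 1`, a shift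
`y` and a weight `w` such that every element of `y + C₁` has Hamming weight
exactly `w`, every element of `C₁ \ C₂` has weight `≥ 3`, and every element of
`C₂^⊥ \ C₁^⊥` has weight `≥ 3`. -/
theorem no_small_CE_CSS_code (n : ℕ) (hn : n ≤ 9) :
    ¬ ∃ (C₁ C₂ : Submodule (ZMod 2) (Fin n → ZMod 2)) (y : Fin n → ZMod 2) (w : ℕ),
        C₂ ≤ C₁
        ∧ Module.finrank (ZMod 2) C₁ = Module.finrank (ZMod 2) C₂ + 1
        ∧ (∀ v ∈ C₁, hammingNorm (y + v) = w)
        ∧ (∀ v ∈ C₁, v ∉ C₂ → 3 ≤ hammingNorm v)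
        ∧ (∀ x ∈ dualCode C₂, x ∉ dualCode C₁ → 3 ≤ hammingNorm x) := by
  rintro ⟨C₁, C₂, y, w, hle, hdim, hy, hX, hZ⟩
  have hy0 : ∀ c ∈ C₁, hammingNorm (y + c) = hammingNorm y := by
    intro c hc
    have h0 := hy 0 C₁.zero_mem
    rw [add_zero] at h0
    rw [hy c hc, h0]
  have hcard := Finset.card_filter_add_card_filter_not (s := (Finset.univ : Finset (Fin n)))
    (fun i => y i ≠ 0)
  simp only [Finset.card_univ, Fintype.card_fin, not_not] at hcard
  by_cases h4 : (Finset.univ.filter (fun i => y i ≠ 0)).card ≤ 4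
  · refine ce_core C₁ C₂ _ h4 hle hdim (fun c hc => ?_) hX hZ
    rw [Finset.filter_filter, ce_weight_add y c, ← ce_weight y c (hy0 c hc), two_mul]
  · have h5 : (Finset.univ.filter (fun i => y i = 0)).card ≤ 4 := by omega
    refine ce_core C₁ C₂ _ h5 hle hdim (fun c hc => ?_) hX hZ
    rw [Finset.filter_filter, ce_weight_add y c, ce_weight y c (hy0 c hc), two_mul]
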